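/- arXiv:2211.10788 — 13 statements merged into one kernel-verified Lean document; each statement's English description precedes it below -/
import Mathlib

section
/- For all integers r ≥ 2 and 1 ≤ k ≤ r-1, gcd(H(r,k), H(r-1,k)) = 1, and for all integers r ≥ 2 and 2 ≤ k ≤ r, gcd(H(r,k), H(r-1,k-1)) = 1. -/
/-- Entry of the determinant Hosoya triangle. -/
def detHosoya (r k : ℕ) : ℕ :=
  Nat.fib (k - 1) * Nat.fib (r - k + 2) + Nat.fib k * Nat.fib (r - k)

/-- Consecutive terms of a Fibonacci-type sequence are coprime if the first two are. -/
theorem coprime_succ_of_fib_recurrence (g : ℕ → ℕ) (hg : ∀ n, g (n + 2) = g n + g (n + 1))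
    (h0 : Nat.Coprime (g 0) (g 1)) (n : ℕ) : Nat.Coprime (g n) (g (n + 1)) := by
  induction n with
  | zero => exact h0
  | succ n ih =>
    rw [hg, Nat.coprime_add_self_right]
    exact ih.symm

theorem coprime_fib_combination_succ_left (m j : ℕ) :
    Nat.Coprime (Nat.fib j * Nat.fib (m + 2) + Nat.fib (j + 1) * Nat.fib m)
      (Nat.fib (j + 1) * Nat.fib (m + 2) + Nat.fib (j + 2) * Nat.fib m) := by
  refine coprime_succ_of_fib_recurrence
    (fun j => Nat.fib j * Nat.fib (m + 2) + Nat.fib (j + 1) * Nat.fib m) (fun n => ?_) ?_ j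
  · simp only [Nat.fib_add_two (n := n), Nat.fib_add_two (n := n + 1)]
    ring
  · simpa [Nat.fib_add_two (n := m)] using Nat.fib_coprime_fib_succ m

theorem coprime_fib_combination_succ_right (j n : ℕ) :
    Nat.Coprime (Nat.fib j * Nat.fib (n + 2) + Nat.fib (j + 1) * Nat.fib n)
      (Nat.fib j * Nat.fib (n + 3) + Nat.fib (j + 1) * Nat.fib (n + 1)) := by
  refine coprime_succ_of_fib_recurrence
    (fun n => Nat.fib j * Nat.fib (n + 2) + Nat.fib (j + 1) * Nat.fib n) (fun n => ?_) ?_ n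
  · simp only [Nat.fib_add_two (n := n + 2), Nat.fib_add_two (n := n)]
    ring
  · have h3 : Nat.fib 3 = 2 := rfl
    simpa [h3] using Nat.fib_coprime_fib_succ j

theorem detHosoya_consecutive_coprime :
    (∀ r k : ℕ, 2 ≤ r → 1 ≤ k → k ≤ r - 1 →
      Nat.gcd (detHosoya r k) (detHosoya (r - 1) k) = 1) ∧
    (∀ r k : ℕ, 2 ≤ r → 2 ≤ k → k ≤ r →
      Nat.gcd (detHosoya r k) (detHosoya (r - 1) (k - 1)) = 1) := by
  constructor
  · intro r k _ hk hkr
    obtain ⟨j, rfl⟩ : ∃ j, k = j + 1 := ⟨k - 1, by omega⟩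
    obtain ⟨n, rfl⟩ : ∃ n, r = j + n + 2 := ⟨r - j - 2, by omega⟩
    have h1 : j + n + 2 - (j + 1) = n + 1 := by omega
    have h2 : j + n + 2 - 1 - (j + 1) = n := by omega
    simp only [detHosoya, h1, h2]
    exact (coprime_fib_combination_succ_right j n).symm
  · intro r k _ hk hkr
    obtain ⟨j, rfl⟩ : ∃ j, k = j + 2 := ⟨k - 2, by omega⟩
    obtain ⟨m, rfl⟩ : ∃ m, r = j + 2 + m := ⟨r - (j + 2), by omega⟩
    have h1 : j + 2 + m - (j + 2) = m := by omega
    have h2 : j + 2 + m - 1 - (j + 2 - 1) = m := by omega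
    simp only [detHosoya, h1, h2]
    exact (coprime_fib_combination_succ_left m j).symm
end

section
/- For all integers r ≥ 1, 1 ≤ m ≤ r and w ≥ 0, gcd(H(r,m), H(r+w,m)) divides F(w); moreover, for all integers r ≥ 1, m ≥ 1 and w ≥ 0, gcd(H(r+m,m), H(r+m+w,m+w)) divides F(w). -/
/-- A sequence with the Fibonacci recurrence is determined by two consecutive terms. -/
lemma fibRec_add_succ {g : ℕ → ℕ} (hg : ∀ n, g (n + 2) = g n + g (n + 1)) (n w : ℕ) :
    g (n + w + 1) = Nat.fib w * g n + Nat.fib (w + 1) * g (n + 1) := by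
  induction w generalizing n with
  | zero => simp
  | succ w ih =>
    rw [show n + (w + 1) + 1 = n + 1 + w + 1 by ring, ih (n + 1), hg n, Nat.fib_add_two]
    ring

lemma fibRec_coprime_succ {g : ℕ → ℕ} (hg : ∀ n, g (n + 2) = g n + g (n + 1))
    (h0 : Nat.Coprime (g 0) (g 1)) (n : ℕ) : Nat.Coprime (g n) (g (n + 1)) := by
  induction n with
  | zero => exact h0
  | succ n ih =>
    rw [hg n]
    simpa using ih.symm

lemma fibRec_gcd_dvd_fib {g : ℕ → ℕ} (hg : ∀ n, g (n + 2) = g n + g (n + 1))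
    (h0 : Nat.Coprime (g 0) (g 1)) (n w : ℕ) : Nat.gcd (g n) (g (n + w)) ∣ Nat.fib w := by
  cases w with
  | zero => simp
  | succ w =>
    have hdvd : Nat.gcd (g n) (g (n + (w + 1))) ∣ Nat.fib (w + 1) * g (n + 1) := by
      refine (Nat.dvd_add_right ((Nat.gcd_dvd_left _ _).mul_left (Nat.fib w))).mp ?_
      rw [← fibRec_add_succ hg]
      exact Nat.gcd_dvd_right _ _
    exact ((fibRec_coprime_succ hg h0 n).coprime_dvd_left
      (Nat.gcd_dvd_left _ _)).dvd_of_dvd_mul_right hdvd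

lemma coprime_fib_two_mul_add_fib_succ (a : ℕ) :
    Nat.Coprime (Nat.fib a) (Nat.fib a * 2 + Nat.fib (a + 1)) := by
  simpa using Nat.fib_coprime_fib_succ a

lemma detHosoya_add_succ (n a : ℕ) :
    detHosoya (n + (a + 1)) (a + 1) =
      Nat.fib a * Nat.fib (n + 2) + Nat.fib (a + 1) * Nat.fib n := by
  simp [detHosoya]

theorem detHosoya_gcd_dvd_fib :
    (∀ r m w : ℕ, 1 ≤ r → 1 ≤ m → m ≤ r →
      Nat.gcd (detHosoya r m) (detHosoya (r + w) m) ∣ Nat.fib w) ∧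
    (∀ r m w : ℕ, 1 ≤ r → 1 ≤ m →
      Nat.gcd (detHosoya (r + m) m) (detHosoya (r + m + w) (m + w)) ∣ Nat.fib w) := by
  constructor
  · intro r m w _ hm hmr
    obtain ⟨a, rfl⟩ := Nat.exists_eq_add_of_le' hm
    obtain ⟨n, rfl⟩ := Nat.exists_eq_add_of_le' hmr
    rw [show n + (a + 1) + w = n + w + (a + 1) by ring]
    refine fibRec_gcd_dvd_fib (g := fun n => detHosoya (n + (a + 1)) (a + 1)) ?_ ?_ n w
    · intro n
      have h : Nat.fib (n + 2 + 2) = Nat.fib (n + 2) + Nat.fib (n + 1 + 2) := Nat.fib_add_two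
      simp only [detHosoya_add_succ, h]
      rw [Nat.fib_add_two (n := n)]
      ring
    · simp only [detHosoya_add_succ]
      simpa [Nat.fib_add_two (n := 1)] using coprime_fib_two_mul_add_fib_succ a
  · intro r m w _ hm
    obtain ⟨a, rfl⟩ := Nat.exists_eq_add_of_le' hm
    rw [show r + (a + 1) + w = r + (a + w + 1) by ring, show a + 1 + w = a + w + 1 by ring]
    refine fibRec_gcd_dvd_fib (g := fun a => detHosoya (r + (a + 1)) (a + 1)) ?_ ?_ a w
    · intro a
      simp only [detHosoya_add_succ, Nat.fib_add_two (n := a),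
        show a + 2 + 1 = a + 1 + 2 by ring, Nat.fib_add_two (n := a + 1)]
      ring
    · simp only [detHosoya_add_succ]
      convert coprime_fib_two_mul_add_fib_succ r using 1
      · simp
      · simp [Nat.fib_add_two]
        ring
end

section
/- For all integers r, k with 1 ≤ k ≤ r, the Fibonacci number F(gcd(r+2, k+1)) divides H(r,k), and the Fibonacci number F(gcd(r+2, k)) divides H(r,k). -/
theorem fib_gcd_dvd_detHosoya (r k : ℕ) (hk : 1 ≤ k) (hkr : k ≤ r) :
    Nat.fib (Nat.gcd (r + 2) (k + 1)) ∣ detHosoya r k ∧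
    Nat.fib (Nat.gcd (r + 2) k) ∣ detHosoya r k := by
  obtain ⟨j, rfl⟩ := Nat.exists_eq_add_of_le' hk
  obtain ⟨m, rfl⟩ := Nat.exists_eq_add_of_le' hkr
  simp only [detHosoya, Nat.add_sub_cancel]
  constructor
  · have hj : Nat.gcd (m + (j + 1) + 2) (j + 1 + 1) ∣ j + 2 := Nat.gcd_dvd_right _ _
    have hm : Nat.gcd (m + (j + 1) + 2) (j + 1 + 1) ∣ m + 1 := by
      refine (Nat.dvd_add_left hj).1 ?_
      convert Nat.gcd_dvd_left (m + (j + 1) + 2) (j + 1 + 1) using 1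
      ring
    have h : Nat.fib j * Nat.fib (m + 2) + Nat.fib (j + 1) * Nat.fib m =
        Nat.fib j * Nat.fib (m + 1) + Nat.fib m * Nat.fib (j + 2) := by
      rw [Nat.fib_add_two, Nat.fib_add_two]
      ring
    rw [h]
    exact dvd_add ((Nat.isDvdSequence_fib _ _ hm).mul_left _) ((Nat.isDvdSequence_fib _ _ hj).mul_left _)
  · have hj : Nat.gcd (m + (j + 1) + 2) (j + 1) ∣ j + 1 := Nat.gcd_dvd_right _ _
    have hm : Nat.gcd (m + (j + 1) + 2) (j + 1) ∣ m + 2 := by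
      refine (Nat.dvd_add_left hj).1 ?_
      convert Nat.gcd_dvd_left (m + (j + 1) + 2) (j + 1) using 1
      ring
    exact dvd_add ((Nat.isDvdSequence_fib _ _ hm).mul_left _) ((Nat.isDvdSequence_fib _ _ hj).mul_right _)
end

section
/- For all integers r, k with 1 ≤ k ≤ r, the entry H(r,k) is divisible by 2 if and only if r ≡ 1 (mod 3). -/
theorem Nat.fib_mod_two (n : ℕ) : Nat.fib n % 2 = if n % 3 = 0 then 0 else 1 := by
  induction n using Nat.twoStepInduction with
  | zero => simp
  | one => simp
  | more n h₀ h₁ =>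
    rw [Nat.fib_add_two, Nat.add_mod, h₀, h₁]
    have h : n % 3 = 0 ∨ n % 3 = 1 ∨ n % 3 = 2 := by omega
    rcases h with h | h | h <;> simp [Nat.add_mod, h]

theorem detHosoya_even_iff (r k : ℕ) (hk : 1 ≤ k) (hkr : k ≤ r) :
    2 ∣ detHosoya r k ↔ r % 3 = 1 := by
  obtain ⟨b, rfl⟩ := Nat.exists_eq_add_of_le hkr
  obtain ⟨a, rfl⟩ := Nat.exists_eq_add_of_le' hk
  have ha : a % 3 = 0 ∨ a % 3 = 1 ∨ a % 3 = 2 := by omega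
  have hb : b % 3 = 0 ∨ b % 3 = 1 ∨ b % 3 = 2 := by omega
  rw [detHosoya, Nat.add_sub_cancel, Nat.add_sub_cancel_left, Nat.dvd_iff_mod_eq_zero,
    Nat.add_mod, Nat.mul_mod, Nat.mul_mod (Nat.fib (a + 1))]
  simp only [Nat.fib_mod_two]
  rcases ha with ha | ha | ha <;> rcases hb with hb | hb | hb <;> simp [Nat.add_mod, ha, hb]
end

section
/- For every prime p, the prime p divides the Fibonacci number F(p - ε(p)) (so p divides F(p-1) when p ≡ ±1 (mod 5), p divides F(p+1) when p ≡ ±2 (mod 5), and 5 divides F(5)). -/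
/-- Binet's formula for the roots `a` and `b` of `X ^ 2 - X - 1` in a commutative ring. -/
lemma sub_mul_fib_eq_pow_sub_pow {R : Type*} [CommRing R] {a b : R} (hab : a + b = 1)
    (hmul : a * b = -1) (n : ℕ) : (a - b) * (Nat.fib n : R) = a ^ n - b ^ n := by
  induction n using Nat.twoStepInduction with
  | zero => simp
  | one => simp
  | more n ih₁ ih₂ =>
    rw [Nat.fib_add_two]
    push_cast
    linear_combination ih₁ + ih₂ + (b ^ (n + 1) - a ^ (n + 1)) * hab + (a ^ n - b ^ n) * hmul

lemma exists_roots_frobenius (p : ℕ) [Fact p.Prime] (hp2 : p ≠ 2) (hp5 : p ≠ 5) :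
    ∃ a b : AlgebraicClosure (ZMod p), a + b = 1 ∧ a * b = -1 ∧ a - b ≠ 0 ∧
      (a - b) ^ p = (legendreSym p 5 : AlgebraicClosure (ZMod p)) * (a - b) := by
  let K := AlgebraicClosure (ZMod p)
  have hp : p.Prime := Fact.out
  have : CharP K p := charP_of_injective_algebraMap (algebraMap (ZMod p) K).injective p
  have h2 : (2 : K) ≠ 0 := fun h ↦ hp2 <|
    (Nat.prime_dvd_prime_iff_eq hp Nat.prime_two).1 ((CharP.cast_eq_zero_iff K p 2).1 (mod_cast h))
  have h5 : (5 : K) ≠ 0 := fun h ↦ hp5 <|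
    (Nat.prime_dvd_prime_iff_eq hp Nat.prime_five).1 ((CharP.cast_eq_zero_iff K p 5).1 (mod_cast h))
  obtain ⟨s, hs⟩ := IsAlgClosed.exists_pow_nat_eq (5 : K) two_pos
  have hs0 : s ≠ 0 := by
    rintro rfl
    exact h5 (by simpa using hs.symm)
  have hsub : (1 + s) / 2 - (1 - s) / 2 = s := by
    rw [← sub_div, div_eq_iff h2]
    ring
  refine ⟨(1 + s) / 2, (1 - s) / 2, by rw [← add_div, div_eq_one_iff_eq h2]; ring,
    ?_, by rwa [hsub], ?_⟩
  · field_simp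
    linear_combination -hs
  · have hL : ((legendreSym p 5 : ℤ) : K) = 5 ^ (p / 2) := by
      simpa [map_ofNat] using congrArg (algebraMap (ZMod p) K) (legendreSym.eq_pow p 5)
    rw [hsub, hL, ← hs, ← pow_mul, ← pow_succ,
      Nat.two_mul_div_two_add_one_of_odd (hp.odd_of_ne_two hp2)]

lemma prime_dvd_fib_sub_one (p : ℕ) [Fact p.Prime] (hp2 : p ≠ 2) (hp5 : p ≠ 5)
    (h : legendreSym p 5 = 1) : p ∣ Nat.fib (p - 1) := by
  let K := AlgebraicClosure (ZMod p)
  obtain ⟨a, b, hab, hmul, hne, hfr⟩ := exists_roots_frobenius p hp2 hp5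
  have : CharP K p := charP_of_injective_algebraMap (algebraMap (ZMod p) K).injective p
  have h2 : (2 : K) ≠ 0 := Ring.two_ne_zero (by rwa [ringChar.eq K p])
  have hp : p.Prime := Fact.out
  have hadd : a ^ p + b ^ p = 1 := by rw [← add_pow_char, hab, one_pow]
  rw [sub_pow_char, h, Int.cast_one, one_mul] at hfr
  have ha : a ^ p = a := mul_left_cancel₀ h2 (by linear_combination hadd + hfr - hab)
  have hb : b ^ p = b := by linear_combination hadd - ha - hab
  have key (x : K) (hx : x ≠ 0) (hxp : x ^ p = x) : x ^ (p - 1) = 1 :=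
    mul_right_cancel₀ hx (by rw [pow_sub_one_mul hp.ne_zero, hxp, one_mul])
  have ha0 : a ≠ 0 := by rintro rfl; simp at hmul
  have hb0 : b ≠ 0 := by rintro rfl; simp at hmul
  have hF := sub_mul_fib_eq_pow_sub_pow hab hmul (p - 1)
  rw [key a ha0 ha, key b hb0 hb, sub_self] at hF
  exact (CharP.cast_eq_zero_iff K p _).1 ((mul_eq_zero.1 hF).resolve_left hne)

lemma prime_dvd_fib_add_one (p : ℕ) [Fact p.Prime] (hp2 : p ≠ 2) (hp5 : p ≠ 5)
    (h : legendreSym p 5 = -1) : p ∣ Nat.fib (p + 1) := by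
  let K := AlgebraicClosure (ZMod p)
  obtain ⟨a, b, hab, hmul, hne, hfr⟩ := exists_roots_frobenius p hp2 hp5
  have : CharP K p := charP_of_injective_algebraMap (algebraMap (ZMod p) K).injective p
  have h2 : (2 : K) ≠ 0 := Ring.two_ne_zero (by rwa [ringChar.eq K p])
  have hadd : a ^ p + b ^ p = 1 := by rw [← add_pow_char, hab, one_pow]
  rw [sub_pow_char, h] at hfr
  push_cast at hfr
  have ha : a ^ p = b := mul_left_cancel₀ h2 (by linear_combination hadd + hfr - hab)
  have hb : b ^ p = a := by linear_combination hadd - ha - hab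
  have hF := sub_mul_fib_eq_pow_sub_pow hab hmul (p + 1)
  rw [pow_succ, pow_succ, ha, hb, mul_comm b a, sub_self] at hF
  exact (CharP.cast_eq_zero_iff K p _).1 ((mul_eq_zero.1 hF).resolve_left hne)

instance fact_prime_five : Fact (Nat.Prime 5) := ⟨Nat.prime_five⟩

lemma legendreSym_five (p : ℕ) [Fact p.Prime] (hp2 : p ≠ 2) :
    legendreSym p 5 = legendreSym 5 (p % 5 : ℕ) := by
  have h := legendreSym.quadratic_reciprocity_one_mod_four (p := 5) (q := p) (by norm_num) hp2
  rw [legendreSym.mod 5 p] at h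
  exact_mod_cast h

theorem prime_dvd_fib_sub_legendre (p : ℕ) (hp : p.Prime) :
    ((p % 5 = 1 ∨ p % 5 = 4) → p ∣ Nat.fib (p - 1)) ∧
    ((p % 5 = 2 ∨ p % 5 = 3) → p ∣ Nat.fib (p + 1)) ∧
    (p = 5 → p ∣ Nat.fib 5) := by
  have := Fact.mk hp
  refine ⟨fun h ↦ ?_, fun h ↦ ?_, ?_⟩
  · have hp2 : p ≠ 2 := by rintro rfl; simp at h
    refine prime_dvd_fib_sub_one p hp2 (by rintro rfl; simp at h) ?_
    rw [legendreSym_five p hp2]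
    rcases h with h | h <;> rw [h] <;> decide
  · obtain rfl | hp2 := eq_or_ne p 2
    · decide
    refine prime_dvd_fib_add_one p hp2 (by rintro rfl; simp at h) ?_
    rw [legendreSym_five p hp2]
    rcases h with h | h <;> rw [h] <;> decide
  · rintro rfl
    decide
end

section
/- Let p be a prime with p ≡ ±1 (mod 5) and let t ≥ 1 be an integer with 2t ≤ p. Then H(p, 2t) ≡ 2·F(2t-1)^2 (mod p). -/
theorem pow_succ_eq_fib_mul_add_fib {R : Type*} [CommRing R] {s : R} (hs : s ^ 2 = s + 1)
    (n : ℕ) : s ^ (n + 1) = Nat.fib (n + 1) * s + Nat.fib n := by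
  induction n with
  | zero => simp
  | succ k ih =>
    rw [pow_succ, ih, Nat.fib_add_two]
    push_cast
    linear_combination (Nat.fib (k + 1) : R) * hs

theorem isSquare_five_zmod {p : ℕ} [Fact p.Prime] (h5 : p % 5 = 1 ∨ p % 5 = 4) (hp2 : p ≠ 2) :
    IsSquare (5 : ZMod p) := by
  have : Fact (Nat.Prime 5) := ⟨Nat.prime_five⟩
  have h : IsSquare (p : ZMod 5) := by
    rw [← ZMod.natCast_mod p 5]
    rcases h5 with h | h <;> rw [h]
    · exact ⟨1, by norm_num⟩
    · exact ⟨2, by norm_num⟩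
  exact_mod_cast (ZMod.exists_sq_eq_prime_iff_of_mod_four_eq_one (p := 5) (q := p)
    (by norm_num) hp2).1 h

theorem fib_prime_sub_two_and_sub_one {p : ℕ} [Fact p.Prime] (h5 : p % 5 = 1 ∨ p % 5 = 4) :
    (Nat.fib (p - 2) : ZMod p) = 1 ∧ (Nat.fib (p - 1) : ZMod p) = 0 := by
  have hp : p.Prime := Fact.out
  have hp2 : p ≠ 2 := by omega
  have two_ne : (2 : ZMod p) ≠ 0 := by
    have h : ¬ p ∣ 2 := fun h => hp2 ((Nat.prime_dvd_prime_iff_eq hp Nat.prime_two).1 h)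
    exact_mod_cast mt (ZMod.natCast_eq_zero_iff 2 p).1 h
  have five_ne : (5 : ZMod p) ≠ 0 := by
    have h : ¬ p ∣ 5 := fun h => by
      have := (Nat.prime_dvd_prime_iff_eq hp Nat.prime_five).1 h
      omega
    exact_mod_cast mt (ZMod.natCast_eq_zero_iff 5 p).1 h
  obtain ⟨r, hr⟩ := isSquare_five_zmod h5 hp2
  have hr0 : r ≠ 0 := by
    rintro rfl
    exact five_ne (by simpa using hr)
  have key : ∀ s : ZMod p, s ^ 2 = s + 1 →
      (Nat.fib (p - 1) : ZMod p) * s + Nat.fib (p - 2) = 1 := by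
    intro s hs
    have hs0 : s ≠ 0 := by
      rintro rfl
      simp at hs
    have h := pow_succ_eq_fib_mul_add_fib hs (p - 2)
    rw [show p - 2 + 1 = p - 1 by have := hp.two_le; omega,
      ZMod.pow_card_sub_one_eq_one hs0] at h
    exact h.symm
  have h1 := key ((1 + r) / 2) (by field_simp; linear_combination -hr)
  have h2 := key ((1 - r) / 2) (by field_simp; linear_combination -hr)
  have h0 : (Nat.fib (p - 1) : ZMod p) = 0 := by
    have h : (Nat.fib (p - 1) : ZMod p) * r = 0 := by
      field_simp at h1 h2
      apply mul_left_cancel₀ two_ne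
      linear_combination h1 - h2
    exact (mul_eq_zero.1 h).resolve_right hr0
  refine ⟨?_, h0⟩
  simpa [h0] using h1

theorem fib_prime_sub_even {p : ℕ} [Fact p.Prime] (h5 : p % 5 = 1 ∨ p % 5 = 4) (t : ℕ)
    (htp : 2 * t + 2 ≤ p) :
    (Nat.fib (p - (2 * t + 2)) : ZMod p) = Nat.fib (2 * t + 1) ∧
      (Nat.fib (p - (2 * t + 2) + 1) : ZMod p) = -Nat.fib (2 * t) := by
  induction t with
  | zero =>
    obtain ⟨h1, h2⟩ := fib_prime_sub_two_and_sub_one (p := p) h5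
    rw [show p - 1 = p - (2 * 0 + 2) + 1 by omega] at h2
    simpa using And.intro h1 h2
  | succ t ih =>
    obtain ⟨n, hn⟩ := Nat.exists_eq_add_of_le htp
    obtain ⟨h1, h2⟩ := ih (by omega)
    rw [show p - (2 * t + 2) = n + 2 by omega] at h1 h2
    rw [show p - (2 * (t + 1) + 2) = n by omega,
      show 2 * (t + 1) = 2 * t + 2 by ring]
    have e1 := Nat.fib_add_two (n := n)
    have e2 := Nat.fib_add_two (n := n + 1)
    have e3 := Nat.fib_add_two (n := 2 * t)
    have e4 := Nat.fib_add_two (n := 2 * t + 1)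
    apply_fun (Nat.cast : ℕ → ZMod p) at e1 e2 e3 e4
    rw [Nat.cast_add] at e1 e2 e3 e4
    constructor
    · linear_combination 2 * h1 - h2 - e1 + e2 - e4 - e3
    · linear_combination h2 - h1 - e2 + e3

theorem detHosoya_prime_row_even_col (p t : ℕ) (hp : p.Prime)
    (h5 : p % 5 = 1 ∨ p % 5 = 4) (ht : 1 ≤ t) (htp : 2 * t ≤ p) :
    detHosoya p (2 * t) ≡ 2 * Nat.fib (2 * t - 1) ^ 2 [MOD p] := by
  have : Fact p.Prime := ⟨hp⟩
  obtain ⟨t, rfl⟩ := Nat.exists_eq_add_of_le' ht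
  obtain ⟨h1, h2⟩ := fib_prime_sub_even h5 t htp
  rw [← ZMod.natCast_eq_natCast_iff, detHosoya, show 2 * (t + 1) = 2 * t + 2 by ring,
    show 2 * t + 2 - 1 = 2 * t + 1 by omega, Nat.fib_add_two, Nat.fib_add_two (n := 2 * t)]
  push_cast
  rw [h1, h2]
  ring
end

section
/- Let p be a prime with p ≡ ±2 (mod 5) and let t ≥ 1 be an integer with 2t+1 ≤ p. Then H(p, 2t+1) ≡ 2·F(2t+1)^2 - 1 (mod p), where the congruence is taken in the integers. -/
/-- Binet's formula, division-free, in an arbitrary commutative ring. -/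
theorem pow_sub_pow_eq_sub_mul_fib {R : Type*} [CommRing R] {a b : R}
    (ha : a ^ 2 = a + 1) (hb : b ^ 2 = b + 1) (n : ℕ) :
    a ^ n - b ^ n = (a - b) * (Nat.fib n : R) := by
  induction n using Nat.twoStepInduction with
  | zero => simp
  | one => simp
  | more n ih₁ ih₂ =>
    rw [Nat.fib_add_two]
    push_cast
    linear_combination ih₁ + ih₂ + a ^ n * ha - b ^ n * hb

/-- Cassini's identity at an odd index. -/
theorem Nat.fib_two_mul_add_one_cassini {R : Type*} [CommRing R] (t : ℕ) :
    (Nat.fib (2 * t + 1) : R) ^ 2 - Nat.fib (2 * t) * Nat.fib (2 * t + 1)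
      - (Nat.fib (2 * t) : R) ^ 2 = 1 := by
  induction t with
  | zero => simp
  | succ t ih =>
    rw [show 2 * (t + 1) + 1 = 2 * t + 1 + 2 by ring, show 2 * (t + 1) = 2 * t + 2 by ring,
      Nat.fib_add_two (n := 2 * t + 1), show 2 * t + 1 + 1 = 2 * t + 2 by ring,
      Nat.fib_add_two (n := 2 * t)]
    push_cast
    linear_combination ih

/-- `5` is a quadratic non-residue modulo an odd prime `p ≡ ±2 (mod 5)`. -/
theorem ZMod.five_pow_half_eq_neg_one {p : ℕ} [Fact p.Prime] (hp2 : p ≠ 2)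
    (h5 : p % 5 = 2 ∨ p % 5 = 3) : (5 : ZMod p) ^ (p / 2) = -1 := by
  have two_nsq : ¬ IsSquare ((2 : ℕ) : ZMod 5) := by decide
  have three_nsq : ¬ IsSquare ((3 : ℕ) : ZMod 5) := by decide
  have : Fact (Nat.Prime 5) := ⟨by norm_num⟩
  have hne : (5 : ZMod p) ≠ 0 := by
    intro h
    have hdvd : p ∣ 5 := (ZMod.natCast_eq_zero_iff 5 p).1 (by exact_mod_cast h)
    have := (Nat.prime_dvd_prime_iff_eq Fact.out (by norm_num)).1 hdvd
    omega
  have hnsq : ¬ IsSquare (5 : ZMod p) := by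
    intro h
    have hsq : IsSquare (p : ZMod 5) :=
      (ZMod.exists_sq_eq_prime_iff_of_mod_four_eq_one (p := 5) (q := p)
        (by norm_num) hp2).2 (by exact_mod_cast h)
    rw [← ZMod.natCast_mod] at hsq
    rcases h5 with h | h <;> rw [h] at hsq
    exacts [two_nsq hsq, three_nsq hsq]
  exact (ZMod.pow_div_two_eq_neg_one_or_one p hne).resolve_left
    fun h => hnsq ((ZMod.euler_criterion p hne).2 h)

/-- If `s` is a square root of `5` in a field of odd characteristic `p ≡ ±2 (mod 5)`, then the
Frobenius map sends `s` to `-s`. -/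
theorem pow_char_eq_neg_of_sq_eq_five {p : ℕ} [Fact p.Prime] (hp2 : p ≠ 2)
    (h5 : p % 5 = 2 ∨ p % 5 = 3) {K : Type*} [Field K] [Algebra (ZMod p) K]
    {s : K} (hs : s ^ 2 = 5) : s ^ p = -s := by
  have hodd : p % 2 = 1 := (Fact.out : p.Prime).eq_two_or_odd.resolve_left hp2
  have hhalf : (5 : K) ^ (p / 2) = -1 := by
    have h := congrArg (algebraMap (ZMod p) K) (ZMod.five_pow_half_eq_neg_one hp2 h5)
    rwa [map_pow, map_neg, map_one, map_ofNat] at h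
  calc s ^ p = s ^ (2 * (p / 2) + 1) := by congr 1; omega
    _ = -s := by rw [pow_succ, pow_mul, hs, hhalf, neg_one_mul]

/-- In a field of odd characteristic `p ≡ ±2 (mod 5)` containing a square root of `5`,
`F(p) = -1` and `F(p + 1) = 0`. -/
theorem fib_char_eq_neg_one_and_fib_succ_eq_zero {p : ℕ} [Fact p.Prime] (hp2 : p ≠ 2)
    (h5 : p % 5 = 2 ∨ p % 5 = 3) {K : Type*} [Field K] [Algebra (ZMod p) K]
    {s : K} (hs : s ^ 2 = 5) :
    (Nat.fib p : K) = -1 ∧ (Nat.fib (p + 1) : K) = 0 := by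
  have : CharP K p := charP_of_injective_algebraMap (algebraMap (ZMod p) K).injective p
  have two_ne : (2 : K) ≠ 0 := Ring.two_ne_zero (by rwa [ringChar.eq K p])
  have hsp : s ^ p = -s := pow_char_eq_neg_of_sq_eq_five hp2 h5 hs
  have hs0 : s ≠ 0 := by
    rintro rfl
    have hdvd : p ∣ 5 := (CharP.cast_eq_zero_iff K p 5).1 (by push_cast; rw [← hs]; ring)
    have := (Nat.prime_dvd_prime_iff_eq Fact.out (by norm_num)).1 hdvd
    omega
  have h2p : (2 : K) ^ p = 2 := by
    have h := congrArg (algebraMap (ZMod p) K) (ZMod.pow_card (2 : ZMod p))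
    rwa [map_pow, map_ofNat] at h
  obtain ⟨a, ha⟩ : ∃ a : K, a = (1 + s) / 2 := ⟨_, rfl⟩
  obtain ⟨b, hb⟩ : ∃ b : K, b = (1 - s) / 2 := ⟨_, rfl⟩
  have haq : a ^ 2 = a + 1 := by
    rw [ha]; field_simp; linear_combination hs
  have hbq : b ^ 2 = b + 1 := by
    rw [hb]; field_simp; linear_combination hs
  have hab : a - b = s := by
    rw [ha, hb]; field_simp; ring
  have hap : a ^ p = b := by
    rw [ha, div_pow, add_pow_char, hsp, h2p, hb, one_pow, sub_eq_add_neg]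
  have hbp : b ^ p = a := by
    rw [hb, div_pow, sub_pow_char, hsp, h2p, ha, one_pow, sub_neg_eq_add]
  have binet := pow_sub_pow_eq_sub_mul_fib haq hbq
  constructor <;> apply mul_left_cancel₀ hs0 <;> rw [← hab, ← binet]
  · rw [hap, hbp]
    ring
  · rw [pow_succ, pow_succ, hap, hbp]
    ring

/-- For an odd prime `p ≡ ±2 (mod 5)`, `F(p) ≡ -1` and `F(p + 1) ≡ 0` modulo `p`. -/
theorem ZMod.fib_prime_eq_neg_one_and_fib_succ_eq_zero {p : ℕ} [Fact p.Prime] (hp2 : p ≠ 2)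
    (h5 : p % 5 = 2 ∨ p % 5 = 3) :
    (Nat.fib p : ZMod p) = -1 ∧ (Nat.fib (p + 1) : ZMod p) = 0 := by
  obtain ⟨s, hs⟩ :=
    IsAlgClosed.exists_pow_nat_eq (5 : AlgebraicClosure (ZMod p)) (n := 2) (by norm_num)
  obtain ⟨h₁, h₂⟩ := fib_char_eq_neg_one_and_fib_succ_eq_zero hp2 h5 hs
  have inj := (algebraMap (ZMod p) (AlgebraicClosure (ZMod p))).injective
  exact ⟨inj (by rw [map_natCast, map_neg, map_one, h₁]), inj (by rw [map_natCast, map_zero, h₂])⟩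

theorem detHosoya_prime_row_odd_col (p t : ℕ) (hp : p.Prime)
    (h5 : p % 5 = 2 ∨ p % 5 = 3) (ht : 1 ≤ t) (htp : 2 * t + 1 ≤ p) :
    (detHosoya p (2 * t + 1) : ℤ) ≡ 2 * (Nat.fib (2 * t + 1) : ℤ) ^ 2 - 1 [ZMOD p] := by
  have : Fact p.Prime := ⟨hp⟩
  obtain ⟨h₁, h₂⟩ := ZMod.fib_prime_eq_neg_one_and_fib_succ_eq_zero (p := p) (by omega) h5
  obtain ⟨m, hm⟩ := Nat.exists_eq_add_of_le htp
  have e₁ : Nat.fib p = Nat.fib (2 * t) * Nat.fib m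
      + Nat.fib (2 * t + 1) * Nat.fib (m + 1) := by
    rw [← Nat.fib_add, hm, Nat.add_right_comm]
  have e₂ : Nat.fib (p + 1) = Nat.fib (2 * t + 1) * Nat.fib m
      + (Nat.fib (2 * t) + Nat.fib (2 * t + 1)) * Nat.fib (m + 1) := by
    rw [← Nat.fib_add_two, ← Nat.fib_add, hm]
  have hH : detHosoya p (2 * t + 1) = Nat.fib (2 * t) * (Nat.fib m + Nat.fib (m + 1))
      + Nat.fib (2 * t + 1) * Nat.fib m := by
    rw [detHosoya, ← Nat.fib_add_two, show p - (2 * t + 1) = m by omega, Nat.add_sub_cancel]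
  rw [e₁] at h₁
  rw [e₂] at h₂
  rw [← ZMod.intCast_eq_intCast_iff, hH]
  push_cast at h₁ h₂ ⊢
  have hc := Nat.fib_two_mul_add_one_cassini (R := ZMod p) t
  generalize (Nat.fib (2 * t) : ZMod p) = a at *
  generalize (Nat.fib (2 * t + 1) : ZMod p) = b at *
  generalize (Nat.fib m : ZMod p) = x at *
  generalize (Nat.fib (m + 1) : ZMod p) = y at *
  have hx : x = a + b := by linear_combination -(a + b) * h₁ + b * h₂ - x * hc
  have hy : y = -b := by linear_combination b * h₁ - a * h₂ - y * hc
  rw [hx, hy]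
  linear_combination -hc
end

section
/- For all integers n, k, t with 2 ≤ k ≤ n and t ≥ 1: H(n+t, k+t) = F(t+1)·H(n,k) + F(t)·H(n-1, k-1); and for all integers n, k, t with 1 ≤ k ≤ n-1, n ≥ 2 and t ≥ 1: H(n+t, k) = F(t+1)·H(n,k) + F(t)·H(n-1, k). -/
theorem fib_succ_add (m t : ℕ) :
    Nat.fib (m + 1 + t) = Nat.fib (t + 1) * Nat.fib (m + 1) + Nat.fib t * Nat.fib m := by
  rw [show m + 1 + t = m + t + 1 by ring, Nat.fib_add]
  ring

theorem detHosoya_shift :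
    (∀ n k t : ℕ, 2 ≤ k → k ≤ n → 1 ≤ t →
      detHosoya (n + t) (k + t) =
        Nat.fib (t + 1) * detHosoya n k + Nat.fib t * detHosoya (n - 1) (k - 1)) ∧
    (∀ n k t : ℕ, 2 ≤ n → 1 ≤ k → k ≤ n - 1 → 1 ≤ t →
      detHosoya (n + t) k =
        Nat.fib (t + 1) * detHosoya n k + Nat.fib t * detHosoya (n - 1) k) := by
  refine ⟨fun n k t hk hkn _ => ?_, fun n k t _ hk hkn _ => ?_⟩
  · obtain ⟨a, rfl⟩ := Nat.exists_eq_add_of_le' hk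
    obtain ⟨d, rfl⟩ := Nat.exists_eq_add_of_le hkn
    simp only [detHosoya,
      show a + 2 + d + t - (a + 2 + t) = d by omega, show a + 2 + t - 1 = a + 1 + t by omega,
      show a + 2 + d - (a + 2) = d by omega, show a + 2 - 1 = a + 1 by omega,
      show a + 2 + d - 1 - (a + 1) = d by omega, show a + 1 - 1 = a by omega]
    rw [fib_succ_add a t, fib_succ_add (a + 1) t]
    ring
  · obtain ⟨d, hd⟩ := Nat.exists_eq_add_of_le hkn
    simp only [detHosoya,
      show n + t - k = d + 1 + t by omega, show n - k = d + 1 by omega,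
      show n - 1 - k = d by omega, show d + 1 + t + 2 = d + 2 + 1 + t by omega]
    rw [fib_succ_add d t, fib_succ_add (d + 2) t]
    ring
end

section
/- (Star property) Let p be an odd prime, let d = p - ε(p), and let n, k be integers with 1 ≤ k ≤ n. If p divides H(n,k), then for every pair of positive integers (n', k') with 1 ≤ k' ≤ n', n' ≡ n (mod d) and k' ≡ k (mod d), p divides H(n',k'). -/
/-- `p - ε(p)` where `ε(p)` is the Legendre symbol `(5/p)`. -/
def dP (p : ℕ) : ℕ :=
  if p % 5 = 1 ∨ p % 5 = 4 then p - 1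
  else if p % 5 = 2 ∨ p % 5 = 3 then p + 1
  else p

/-- Binet's formula over an arbitrary commutative ring. -/
theorem fib_mul_sub_of_add_of_mul {R : Type*} [CommRing R] {a b : R} (hadd : a + b = 1)
    (hmul : a * b = -1) (n : ℕ) : (Nat.fib n : R) * (a - b) = a ^ n - b ^ n := by
  induction n using Nat.twoStepInduction with
  | zero => simp
  | one => simp
  | more n ih0 ih1 =>
    have ha : a ^ 2 = a + 1 := by linear_combination a * hadd - hmul
    have hb : b ^ 2 = b + 1 := by linear_combination b * hadd - hmul
    rw [Nat.fib_add_two, Nat.cast_add]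
    linear_combination ih0 + ih1 - a ^ n * ha + b ^ n * hb

theorem legendreSym_five_of_prime (p : ℕ) [Fact p.Prime] (hp2 : p ≠ 2) :
    legendreSym p 5 = if p % 5 = 1 ∨ p % 5 = 4 then 1
      else if p % 5 = 2 ∨ p % 5 = 3 then -1 else 0 := by
  have : Fact (Nat.Prime 5) := ⟨Nat.prime_five⟩
  have h := legendreSym.quadratic_reciprocity_one_mod_four (p := 5) (q := p) (by norm_num) hp2
  rw [Nat.cast_ofNat] at h
  rw [h, legendreSym.mod, ← Int.natCast_mod]
  have hval : ∀ r < 5, @legendreSym 5 ⟨Nat.prime_five⟩ (r : ℕ) =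
      if r = 1 ∨ r = 4 then 1 else if r = 2 ∨ r = 3 then -1 else 0 := by decide
  exact hval _ (Nat.mod_lt _ (by norm_num))

/-- Evaluating Binet's formula in a field of characteristic `p` containing a square root of `5`. -/
theorem cast_fib_dP_eq_zero {p : ℕ} [Fact p.Prime] (hodd : Odd p) (h5 : p % 5 ≠ 0)
    {K : Type*} [Field K] [Algebra (ZMod p) K] [CharP K p] {s : K} (hs : s ^ 2 = 5) :
    (Nat.fib (dP p) : K) = 0 := by
  have hp : p.Prime := Fact.out
  have hp2 : p ≠ 2 := by rintro rfl; exact absurd hodd (by decide)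
  have hleg := legendreSym_five_of_prime p hp2
  have h2 : (2 : K) ≠ 0 := Ring.two_ne_zero (by rwa [ringChar.eq K p])
  have h5K : (5 : K) ≠ 0 := by
    intro h
    have : ((5 : ℕ) : K) = 0 := by exact_mod_cast h
    rw [CharP.cast_eq_zero_iff K p, Nat.prime_dvd_prime_iff_eq hp Nat.prime_five] at this
    omega
  have hs0 : s ≠ 0 := by rintro rfl; exact h5K (by simpa using hs.symm)
  have hsp : s ^ p = (legendreSym p 5 : K) * s := by
    have h := congrArg (algebraMap (ZMod p) K) (legendreSym.eq_pow p 5)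
    simp only [map_intCast, map_pow, Int.cast_ofNat, map_ofNat] at h
    rw [h, ← hs, ← pow_mul, ← pow_succ, Nat.two_mul_div_two_add_one_of_odd hodd]
  have h2p : (2 : K) ^ p = 2 := by
    simpa only [frobenius_def] using map_ofNat (frobenius K p) 2
  set a : K := (1 + s) / 2 with ha
  set b : K := (1 - s) / 2 with hb
  have hadd : a + b = 1 := by rw [ha, hb]; field_simp; ring
  have hsub : a - b = s := by rw [ha, hb]; field_simp; ring
  have hmul : a * b = -1 := by
    rw [ha, hb]; field_simp; linear_combination -hs
  have ha0 : a ≠ 0 := by intro h; rw [h] at hmul; simp at hmul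
  have hb0 : b ≠ 0 := by intro h; rw [h] at hmul; simp at hmul
  have hap : a ^ p = (1 + s ^ p) / 2 := by
    rw [ha, div_pow, add_pow_char, h2p, one_pow]
  have hbp : b ^ p = (1 - s ^ p) / 2 := by
    rw [hb, div_pow, sub_pow_char, h2p, one_pow]
  have hpow : a ^ dP p = b ^ dP p := by
    by_cases h1 : p % 5 = 1 ∨ p % 5 = 4
    · rw [if_pos h1] at hleg
      simp only [hleg, Int.cast_one, one_mul] at hsp
      rw [hsp] at hap hbp
      have key : ∀ x : K, x ≠ 0 → x ^ p = x → x ^ (p - 1) = 1 := fun x hx h => by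
        apply mul_right_cancel₀ hx
        rw [← pow_succ, Nat.sub_add_cancel hp.one_le, h, one_mul]
      rw [dP, if_pos h1, key a ha0 hap, key b hb0 hbp]
    · have h3 : p % 5 = 2 ∨ p % 5 = 3 := by omega
      rw [if_neg h1, if_pos h3] at hleg
      simp only [hleg, Int.cast_neg, Int.cast_one, neg_mul, one_mul] at hsp
      have hap' : a ^ p = b := by rw [hap, hsp, hb]; ring
      have hbp' : b ^ p = a := by rw [hbp, hsp, ha]; ring
      rw [dP, if_neg h1, if_pos h3, pow_succ, pow_succ, hap', hbp', mul_comm]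
  have hbinet := fib_mul_sub_of_add_of_mul hadd hmul (dP p)
  rw [hpow, sub_self, hsub] at hbinet
  exact (mul_eq_zero.1 hbinet).resolve_right hs0

/-- The rank of apparition of an odd prime `p` in the Fibonacci sequence divides `dP p`. -/
theorem prime_dvd_fib_dP {p : ℕ} (hp : p.Prime) (hodd : Odd p) : p ∣ Nat.fib (dP p) := by
  have : Fact p.Prime := ⟨hp⟩
  by_cases h5 : p % 5 = 0
  · obtain rfl : p = 5 :=
      ((Nat.prime_dvd_prime_iff_eq Nat.prime_five hp).1 (Nat.dvd_of_mod_eq_zero h5)).symm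
    decide
  let K := AlgebraicClosure (ZMod p)
  have : CharP K p := charP_of_injective_algebraMap (algebraMap (ZMod p) K).injective p
  obtain ⟨s, hs⟩ := IsAlgClosed.exists_pow_nat_eq (5 : K) (n := 2) (by norm_num)
  exact (CharP.cast_eq_zero_iff K p _).1 (cast_fib_dP_eq_zero hodd h5 hs)

/-- If `p` divides `fib d`, then modulo `p` the Fibonacci sequence is periodic with period `d`
up to a nonzero scalar. -/
theorem exists_fib_eq_mul_of_modEq {p d : ℕ} [Fact p.Prime] (hd : p ∣ Nat.fib d) {a b : ℕ}
    (h : a ≡ b [MOD d]) :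
    ∃ u : ZMod p, u ≠ 0 ∧ ∀ i, (Nat.fib (a + i) : ZMod p) = u * Nat.fib (b + i) := by
  wlog hba : b ≤ a generalizing a b
  · obtain ⟨u, hu, hf⟩ := this h.symm (le_of_not_ge hba)
    exact ⟨u⁻¹, inv_ne_zero hu, fun i => by rw [hf, inv_mul_cancel_left₀ hu]⟩
  obtain ⟨c, hc⟩ := (Nat.modEq_iff_dvd' hba).1 h.symm
  obtain rfl : a = b + d * c := by omega
  have hd0 : (Nat.fib d : ZMod p) = 0 := (ZMod.natCast_eq_zero_iff _ _).2 hd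
  refine ⟨(Nat.fib (d + 1) : ZMod p) ^ c, pow_ne_zero _ fun h0 => ?_, fun i => ?_⟩
  · exact (Fact.out : p.Prime).not_dvd_one <| (Nat.fib_coprime_fib_succ d) ▸
      Nat.dvd_gcd hd ((ZMod.natCast_eq_zero_iff _ _).1 h0)
  · have step : ∀ m, (Nat.fib (m + d) : ZMod p) = Nat.fib (d + 1) * Nat.fib m := by
      rintro (_ | m)
      · simp [hd0]
      · rw [add_right_comm, Nat.fib_add]
        push_cast
        rw [hd0]
        ring
    clear h hc hba
    induction c with
    | zero => simp
    | succ c ih =>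
      rw [show b + d * (c + 1) + i = b + d * c + i + d by ring, step, ih]
      ring

theorem detHosoya_star_property (p n k : ℕ) (hp : p.Prime) (hodd : Odd p)
    (hk : 1 ≤ k) (hkn : k ≤ n) (hdvd : p ∣ detHosoya n k) :
    ∀ n' k' : ℕ, 1 ≤ k' → k' ≤ n' → n' ≡ n [MOD dP p] → k' ≡ k [MOD dP p] →
      p ∣ detHosoya n' k' := by
  intro n' k' hk' hkn' hn hkk
  have : Fact p.Prime := ⟨hp⟩
  have hd := prime_dvd_fib_dP hp hodd
  obtain ⟨j, rfl⟩ := Nat.exists_eq_add_of_le' hk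
  obtain ⟨j', rfl⟩ := Nat.exists_eq_add_of_le' hk'
  obtain ⟨m, rfl⟩ := Nat.exists_eq_add_of_le hkn
  obtain ⟨m', rfl⟩ := Nat.exists_eq_add_of_le hkn'
  obtain ⟨u, -, hu⟩ := exists_fib_eq_mul_of_modEq hd (Nat.ModEq.add_right_cancel' 1 hkk)
  obtain ⟨v, -, hv⟩ := exists_fib_eq_mul_of_modEq hd (Nat.ModEq.add_left_cancel hkk hn)
  have hu0 := hu 0
  have hv0 := hv 0
  rw [← ZMod.natCast_eq_zero_iff] at hdvd ⊢
  simp only [detHosoya, Nat.add_sub_cancel, Nat.add_sub_cancel_left, Nat.cast_add, Nat.cast_mul,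
    add_zero] at hdvd hu0 hv0 ⊢
  rw [hu0, hv0, hu, hv]
  linear_combination u * v * hdvd
end

section
/- Let p be a prime. (1) If p ≡ 5 (mod 12), then for every integer t ≥ 0 with 4t+1 ≤ p, H(p, 4t+1) is divisible by 3. (2) If p ≡ 11 (mod 12), then for every integer t ≥ 0 with 4t+2 ≤ p, H(p, 4t+2) is divisible by 3. -/
theorem three_dvd_fib_four_mul (n : ℕ) : 3 ∣ Nat.fib (4 * n) :=
  Nat.fib_dvd 4 (4 * n) (dvd_mul_right 4 n)

theorem three_dvd_detHosoya_of_mod_four_eq_one {r t : ℕ} (hr : r % 4 = 1) (ht : 4 * t + 1 ≤ r) :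
    3 ∣ detHosoya r (4 * t + 1) := by
  obtain ⟨s, hs⟩ : ∃ s, r - (4 * t + 1) = 4 * s := ⟨(r - (4 * t + 1)) / 4, by omega⟩
  rw [detHosoya, hs, Nat.add_sub_cancel]
  exact dvd_add ((three_dvd_fib_four_mul t).mul_right _) ((three_dvd_fib_four_mul s).mul_left _)

theorem three_dvd_detHosoya_of_mod_four_eq_three {r t : ℕ} (hr : r % 4 = 3) (ht : 4 * t + 2 ≤ r) :
    3 ∣ detHosoya r (4 * t + 2) := by
  obtain ⟨s, hs⟩ : ∃ s, r - (4 * t + 2) = 4 * s + 1 := ⟨(r - (4 * t + 2)) / 4, by omega⟩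
  obtain ⟨a, ha⟩ := three_dvd_fib_four_mul t
  obtain ⟨b, hb⟩ := three_dvd_fib_four_mul s
  have hsub : 4 * t + 2 - 1 = 4 * t + 1 := rfl
  rw [detHosoya, hs, hsub, Nat.fib_add_two (n := 4 * s + 1), Nat.fib_add_two (n := 4 * s),
    Nat.fib_add_two (n := 4 * t), ha, hb]
  exact ⟨Nat.fib (4 * t + 1) * (b + Nat.fib (4 * s + 1)) + a * Nat.fib (4 * s + 1), by ring⟩

theorem detHosoya_div_three (p : ℕ) (hp : p.Prime) :
    (p % 12 = 5 → ∀ t : ℕ, 4 * t + 1 ≤ p → 3 ∣ detHosoya p (4 * t + 1)) ∧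
    (p % 12 = 11 → ∀ t : ℕ, 4 * t + 2 ≤ p → 3 ∣ detHosoya p (4 * t + 2)) :=
  ⟨fun h _ ht => three_dvd_detHosoya_of_mod_four_eq_one (by omega) ht,
    fun h _ ht => three_dvd_detHosoya_of_mod_four_eq_three (by omega) ht⟩
end

section
/- For every integer m ≥ 1 and every bound B, there exist integers n and k with n ≥ B, k ≥ B and k + m ≤ n such that for all integers i, j with 1 ≤ i ≤ m and 1 ≤ j ≤ m, the entry H(n+i, k+j) is composite, i.e. H(n+i, k+j) > 1 and H(n+i, k+j) is not prime. -/
/-- The shift `(a, b) ↦ (b, a + b)` on pairs, as a permutation. -/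
def fibShift (R : Type*) [AddCommGroup R] : Equiv.Perm (R × R) where
  toFun x := (x.2, x.1 + x.2)
  invFun x := (x.2 - x.1, x.1)
  left_inv x := by ext <;> simp
  right_inv x := by ext <;> simp

theorem fibShift_pow_apply (R : Type*) [Ring R] (n : ℕ) :
    (fibShift R ^ n) (0, 1) = ((Nat.fib n : R), (Nat.fib (n + 1) : R)) := by
  induction n with
  | zero => simp
  | succ n ih =>
    rw [pow_succ', Equiv.Perm.mul_apply, ih, Nat.fib_add_two]
    simp [fibShift]

/-- The Fibonacci sequence is purely periodic modulo every positive integer. -/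
theorem exists_fib_period (N : ℕ) (hN : 0 < N) :
    ∃ P : ℕ, 0 < P ∧ ∀ n, Nat.fib (n + P) ≡ Nat.fib n [MOD N] := by
  have : NeZero N := ⟨hN.ne'⟩
  refine ⟨orderOf (fibShift (ZMod N)), orderOf_pos _, fun n => ?_⟩
  have h := fibShift_pow_apply (ZMod N) (n + orderOf (fibShift (ZMod N)))
  rw [pow_add, pow_orderOf_eq_one, mul_one, fibShift_pow_apply] at h
  exact (ZMod.natCast_eq_natCast_iff _ _ _).1 (Prod.ext_iff.1 h).1.symm

theorem detHosoya_add_modEq {N P : ℕ} (hP : ∀ n, Nat.fib (n + P) ≡ Nat.fib n [MOD N])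
    {r k : ℕ} (hk : 1 ≤ k) :
    detHosoya (r + P) (k + P) ≡ detHosoya r k [MOD N] := by
  unfold detHosoya
  rw [Nat.add_sub_add_right, Nat.sub_add_comm hk]
  exact ((hP _).mul_right _).add ((hP _).mul_right _)

theorem detHosoya_lt_add {P r k : ℕ} (hP : 0 < P) (hk : 3 ≤ k) :
    detHosoya r k < detHosoya (r + P) (k + P) := by
  unfold detHosoya
  rw [Nat.add_sub_add_right]
  refine Nat.add_lt_add_of_lt_of_le ?_ (Nat.mul_le_mul_right _ (Nat.fib_mono (by omega)))
  exact Nat.mul_lt_mul_of_pos_right ((Nat.fib_lt_fib (by omega)).2 (by omega))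
    (Nat.fib_pos.2 (by omega))

theorem one_lt_detHosoya {r k : ℕ} (hk : 2 ≤ k) (hkr : k < r) : 1 < detHosoya r k := by
  unfold detHosoya
  have h₁ := Nat.mul_pos (Nat.fib_pos.2 (show 0 < k - 1 by omega))
    (Nat.fib_pos.2 (show 0 < r - k + 2 by omega))
  have h₂ := Nat.mul_pos (Nat.fib_pos.2 (show 0 < k by omega))
    (Nat.fib_pos.2 (show 0 < r - k by omega))
  omega

theorem detHosoya_composite_neighborhoods (m B : ℕ) (hm : 1 ≤ m) :
    ∃ n k : ℕ, B ≤ n ∧ B ≤ k ∧ k + m ≤ n ∧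
      ∀ i j : ℕ, 1 ≤ i → i ≤ m → 1 ≤ j → j ≤ m →
        1 < detHosoya (n + i) (k + j) ∧ ¬ (detHosoya (n + i) (k + j)).Prime := by
  have hone : ∀ i j : ℕ, 1 ≤ i → j ≤ m → 1 < detHosoya (B + 2 + m + i) (B + 2 + j) :=
    fun i j hi hj => one_lt_detHosoya (by omega) (by omega)
  obtain ⟨P, hP, hper⟩ := exists_fib_period
    (∏ x ∈ Finset.Icc 1 m ×ˢ Finset.Icc 1 m, detHosoya (B + 2 + m + x.1) (B + 2 + x.2)) (by
      refine Finset.prod_pos fun x hx => ?_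
      simp only [Finset.mem_product, Finset.mem_Icc] at hx
      exact zero_lt_one.trans (hone _ _ hx.1.1 hx.2.2))
  refine ⟨B + 2 + m + P, B + 2 + P, by omega, by omega, by omega, fun i j hi him hj hjm => ?_⟩
  rw [Nat.add_right_comm _ P i, Nat.add_right_comm _ P j]
  have hlt := detHosoya_lt_add (r := B + 2 + m + i) (k := B + 2 + j) hP (by omega)
  have hdvd := Finset.dvd_prod_of_mem
    (fun x : ℕ × ℕ => detHosoya (B + 2 + m + x.1) (B + 2 + x.2))
    (show (i, j) ∈ Finset.Icc 1 m ×ˢ Finset.Icc 1 m by simp [hi, him, hj, hjm])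
  have hmod := (detHosoya_add_modEq hper (r := B + 2 + m + i) (k := B + 2 + j)
    (by omega)).of_dvd hdvd
  have hone' := hone i j hi hjm
  exact ⟨hone'.trans hlt,
    Nat.not_prime_of_dvd_of_lt ((hmod.dvd_iff dvd_rfl).2 dvd_rfl) hone' hlt⟩
end

section
/- For all integers n, m with 2 ≤ m ≤ n, the slash-diagonal formula holds: H(n, m) = L(n-m+1)·F(m-1) + F(n-m)·F(m-2), where L denotes the Lucas sequence. -/
/-- Lucas numbers: L 0 = 2, L 1 = 1, L (n+2) = L (n+1) + L n. -/
def lucas : ℕ → ℕ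
  | 0 => 2
  | 1 => 1
  | n + 2 => lucas (n + 1) + lucas n

theorem lucas_succ_eq_fib_add_fib (d : ℕ) :
    lucas (d + 1) = Nat.fib d + Nat.fib (d + 2) := by
  induction d using Nat.twoStepInduction with
  | zero => rfl
  | one => rfl
  | more d ih₀ ih₁ =>
    rw [lucas, ih₀, ih₁, Nat.fib_add_two (n := d + 2), Nat.fib_add_two (n := d)]
    ring

theorem detHosoya_slash_diagonal (n m : ℕ) (hm : 2 ≤ m) (hmn : m ≤ n) :
    detHosoya n m =
      lucas (n - m + 1) * Nat.fib (m - 1) + Nat.fib (n - m) * Nat.fib (m - 2) := by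
  obtain ⟨p, rfl⟩ := Nat.exists_eq_add_of_le' hm
  have h₁ : p + 2 - 1 = p + 1 := rfl
  rw [detHosoya, lucas_succ_eq_fib_add_fib, h₁, Nat.add_sub_cancel, Nat.fib_add_two (n := p)]
  ring
end

section
/- For all integers n ≥ 2 and m ≥ 1, the backslash-diagonal formula holds: H(n+m-1, m) = L(m)·F(n-1) + F(m-1)·F(n-2), where L denotes the Lucas sequence. -/
theorem lucas_succ : ∀ k : ℕ, lucas (k + 1) = Nat.fib (k + 1) + 2 * Nat.fib k
  | 0 => rfl
  | 1 => rfl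
  | k + 2 => by
    rw [lucas, lucas_succ (k + 1), lucas_succ k, Nat.fib_add_two (n := k + 1),
      Nat.fib_add_two (n := k)]
    ring

theorem detHosoya_backslash_diagonal (n m : ℕ) (hn : 2 ≤ n) (hm : 1 ≤ m) :
    detHosoya (n + m - 1) m =
      lucas m * Nat.fib (n - 1) + Nat.fib (m - 1) * Nat.fib (n - 2) := by
  obtain ⟨a, rfl⟩ := Nat.exists_eq_add_of_le' hn
  obtain ⟨k, rfl⟩ := Nat.exists_eq_add_of_le' hm
  have h : a + 2 + (k + 1) - 1 - (k + 1) = a + 1 := by omega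
  rw [detHosoya, h, lucas_succ, Nat.fib_add_two (n := a + 1), Nat.fib_add_two (n := a)]
  simp only [Nat.add_sub_cancel, Nat.add_succ_sub_one]
  ring
end
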